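/- Let Π be a logic program over 𝓛_𝒜 (i.e., no preference atoms occur in Π) and X a consistent set of literals. Then the following statements are equivalent: (1) X is a <_X-preserving answer set of the dynamically ordered program Π (that is, of TA(Π)) and <_X = ∅; (2) X is a <-preserving answer set of the statically ordered program (Π,<) with < = ∅; (3) X is an answer set of Π. -/

import Mathlib

set_option autoImplicit false

namespace ASP

/-- Literals over a set of atoms: an atom or its classical negation. -/
inductive Lit (α : Type) : Type
  | pos : α → Lit α
  | neg : α → Lit α

namespace Lit

/-- The atom of a literal. -/
def atom {α : Type} : Lit α → α
  | pos a => a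
  | neg a => a

/-- Map a function over the atom of a literal. -/
def map {α β : Type} (f : α → β) : Lit α → Lit β
  | pos a => pos (f a)
  | neg a => neg (f a)

end Lit

/-- A rule `head ← bodyP, not bodyN`. -/
structure Rule (α : Type) : Type where
  head : Lit α
  bodyP : Set (Lit α)
  bodyN : Set (Lit α)

/-- Map a function over the atoms of a rule. -/
def Rule.map {α β : Type} (f : α → β) (r : Rule α) : Rule β :=
  ⟨r.head.map f, Lit.map f '' r.bodyP, Lit.map f '' r.bodyN⟩

/-- The literals occurring in a rule. -/
def ruleLits {α : Type} (r : Rule α) : Set (Lit α) := insert r.head (r.bodyP ∪ r.bodyN)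

/-- A set of literals is consistent iff it contains no complementary pair. -/
def consistent {α : Type} (X : Set (Lit α)) : Prop := ¬ ∃ a, Lit.pos a ∈ X ∧ Lit.neg a ∈ X

/-- Logically closed: consistent or the set of all literals. -/
def logClosed {α : Type} (X : Set (Lit α)) : Prop := consistent X ∨ X = Set.univ

/-- The smallest logically closed set of literals containing `S`. -/
def logClosure {α : Type} (S : Set (Lit α)) : Set (Lit α) := ⋂₀ {Y | S ⊆ Y ∧ logClosed Y}

/-- `X` is closed under the (basic) program `P`. -/
def closedUnder {α : Type} (P : Set (Rule α)) (X : Set (Lit α)) : Prop :=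
  ∀ r ∈ P, r.bodyP ⊆ X → r.head ∈ X

/-- `Th P`: smallest set which is logically closed and closed under the basic program `P`. -/
def Th {α : Type} (P : Set (Rule α)) : Set (Lit α) := ⋂₀ {X | logClosed X ∧ closedUnder P X}

/-- A rule is defeated by `X` iff `bodyN r ∩ X ≠ ∅`. -/
def defeated {α : Type} (r : Rule α) (X : Set (Lit α)) : Prop := ∃ L ∈ r.bodyN, L ∈ X

/-- The Gelfond-Lifschitz reduct of `P` relative to `X`. -/
def reduct {α : Type} (P : Set (Rule α)) (X : Set (Lit α)) : Set (Rule α) :=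
  {r' | ∃ r ∈ P, ¬ defeated r X ∧ r' = Rule.mk r.head r.bodyP ∅}

/-- `X` is an answer set of `P` iff `Th (P^X) = X`. -/
def answerSet {α : Type} (P : Set (Rule α)) (X : Set (Lit α)) : Prop := Th (reduct P X) = X

/-- Generating rules of `X` from `P`. -/
def GR {α : Type} (P : Set (Rule α)) (X : Set (Lit α)) : Set (Rule α) :=
  {r | r ∈ P ∧ r.bodyP ⊆ X ∧ ¬ defeated r X}

/-- Heads of the rules occurring before position `i` in the list `l`. -/
def headsBefore {α : Type} (l : List (Rule α)) (i : ℕ) : Set (Lit α) :=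
  {L | L ∈ (l.take i).map Rule.head}

/-- The sequence of rules `l` is grounded. -/
def groundedList {α : Type} (l : List (Rule α)) : Prop :=
  ∀ (i : ℕ) (h : i < l.length),
    consistent (headsBefore l i) → (l.get ⟨i, h⟩).bodyP ⊆ headsBefore l i

/-- `l` is an enumeration of the set `S` of rules. -/
def enumerates {α : Type} (l : List (Rule α)) (S : Set (Rule α)) : Prop :=
  l.Nodup ∧ {r | r ∈ l} = S

/-- The one-step consequence operator for basic programs. -/
def TOp {α : Type} (P : Set (Rule α)) (X : Set (Lit α)) : Set (Lit α) :=
  {L | (consistent X ∧ ∃ r ∈ P, r.bodyP ⊆ X ∧ r.head = L) ∨ ¬ consistent X}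

/-- Iterated application of `TOp`, starting from `∅`. -/
def TIter {α : Type} (P : Set (Rule α)) : ℕ → Set (Lit α)
  | 0 => ∅
  | n + 1 => TOp P (TIter P n)

/-- A strict partial order whose field is contained in `P`. -/
def strictOn {γ : Type} (P : Set γ) (lt : γ → γ → Prop) : Prop :=
  (∀ a b, lt a b → a ∈ P ∧ b ∈ P) ∧ (∀ a b c, lt a b → lt b c → lt a c) ∧ (∀ a, ¬ lt a a)

/-- A total strict order on `P`. -/
def totalStrictOn {γ : Type} (P : Set γ) (ll : γ → γ → Prop) : Prop :=
  (∀ a b, ll a b → a ∈ P ∧ b ∈ P) ∧ (∀ a b c, ll a b → ll b c → ll a c) ∧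
    (∀ a, ¬ ll a a) ∧ (∀ a ∈ P, ∀ b ∈ P, a ≠ b → ll a b ∨ ll b a)

/-! ## Ordered logic programs -/

/-- Atoms of the language of an ordered logic program: regular atoms and
preference atoms `n ≺ m` over names. -/
inductive OAtom (α N : Type) : Type
  | reg : α → OAtom α N
  | pref : N → N → OAtom α N

/-- Rules of an ordered logic program. -/
abbrev ORule (α N : Type) := Rule (OAtom α N)

/-- The preference literal `(n ≺ m)`. -/
def prefLit {α N : Type} (n m : N) : Lit (OAtom α N) := Lit.pos (OAtom.pref n m)

/-- A literal over a regular atom. -/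
def regLitO {α N : Type} (L : Lit (OAtom α N)) : Prop := ∃ a, L.atom = OAtom.reg a

/-- No preference atom occurs in the rule `r`. -/
def noPref {α N : Type} (r : ORule α N) : Prop := ∀ L ∈ ruleLits r, regLitO L

/-- The dynamically induced preference `r <_X r'`, at the level of the language `𝓛`. -/
def precXO {α N : Type} (nm : ORule α N → N) (X : Set (Lit (OAtom α N)))
    (r s : ORule α N) : Prop :=
  prefLit (nm r) (nm s) ∈ X

/-- The fact `(n_r ≺ n_s) ←`. -/
def prefFactO {α N : Type} (nm : ORule α N → N) (r s : ORule α N) : ORule α N :=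
  ⟨prefLit (nm r) (nm s), ∅, ∅⟩

/-- The transitivity rule `t(r,s,t)`. -/
def tRuleO {α N : Type} (nm : ORule α N → N) (r s t : ORule α N) : ORule α N :=
  ⟨prefLit (nm r) (nm t), {prefLit (nm r) (nm s), prefLit (nm s) (nm t)}, ∅⟩

/-- The antisymmetry rule `as(r,s)`. -/
def asRuleO {α N : Type} (nm : ORule α N → N) (r s : ORule α N) : ORule α N :=
  ⟨Lit.neg (OAtom.pref (nm s) (nm r)), {prefLit (nm r) (nm s)}, ∅⟩

/-- `TA(Π)`: `Π` together with all transitivity and antisymmetry rules. -/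
def TA {α N : Type} (P : Set (ORule α N)) (nm : ORule α N → N) : Set (ORule α N) :=
  P ∪ {ru | ∃ r ∈ P, ∃ s ∈ P, ∃ t ∈ P, ru = tRuleO nm r s t}
    ∪ {ru | ∃ r ∈ P, ∃ s ∈ P, ru = asRuleO nm r s}

/-- The statically ordered program `(Π,<)`, identified with
`Π ∪ {(n_r ≺ n_{r'}) ← ∣ r < r'}`. -/
def staticProg {α N : Type} (P : Set (ORule α N)) (nm : ORule α N → N)
    (lt : ORule α N → ORule α N → Prop) : Set (ORule α N) :=
  P ∪ {ru | ∃ r ∈ P, ∃ s ∈ P, lt r s ∧ ru = prefFactO nm r s}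

/-- The heads of the generating rules occurring before position `i` in `l`. -/
def grHeadsBefore {α : Type} (l : List (Rule α)) (G : Set (Rule α)) (i : ℕ) :
    Set (Lit α) :=
  {L | ∃ j, ∃ h : j < l.length, j < i ∧ l.get ⟨j, h⟩ ∈ G ∧ (l.get ⟨j, h⟩).head = L}

/-- `X` is a `<`-preserving answer set of the statically ordered program `(P,lt)`
(Definition 1). -/
def staticPreserving {α N : Type} (P : Set (ORule α N))
    (lt : ORule α N → ORule α N → Prop) (X : Set (Lit (OAtom α N))) : Prop :=
  answerSet P X ∧ consistent X ∧
    ∃ l : List (ORule α N), enumerates l (GR P X) ∧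
      (∀ (i : ℕ) (h : i < l.length), (l.get ⟨i, h⟩).bodyP ⊆ headsBefore l i) ∧
      (∀ (i j : ℕ) (hi : i < l.length) (hj : j < l.length),
        lt (l.get ⟨i, hi⟩) (l.get ⟨j, hj⟩) → j < i) ∧
      (∀ (i : ℕ) (hi : i < l.length), ∀ r' ∈ P, r' ∉ GR P X →
        lt (l.get ⟨i, hi⟩) r' →
          ¬ r'.bodyP ⊆ X ∨ ∃ L ∈ r'.bodyN, L ∈ headsBefore l i)

/-- `X` is a `<_X`-preserving answer set of the program `P` (standing for `TA(Π)`;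
Definition 3). -/
def dynPreserving {α N : Type} (nm : ORule α N → N) (P : Set (ORule α N))
    (X : Set (Lit (OAtom α N))) : Prop :=
  answerSet P X ∧ consistent X ∧
    ∃ l : List (ORule α N), enumerates l P ∧
      (∀ (i j : ℕ) (hi : i < l.length) (hj : j < l.length),
        precXO nm X (l.get ⟨i, hi⟩) (l.get ⟨j, hj⟩) → j < i) ∧
      (∀ (i j : ℕ) (hi : i < l.length) (hj : j < l.length),
        precXO nm X (l.get ⟨i, hi⟩) (l.get ⟨j, hj⟩) →
          ∃ k, ∃ hk : k < l.length, k < i ∧ l.get ⟨k, hk⟩ ∈ GR P X ∧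
            (l.get ⟨k, hk⟩).head = prefLit (nm (l.get ⟨i, hi⟩)) (nm (l.get ⟨j, hj⟩))) ∧
      (∀ (i : ℕ) (hi : i < l.length), l.get ⟨i, hi⟩ ∈ GR P X →
        (l.get ⟨i, hi⟩).bodyP ⊆ grHeadsBefore l (GR P X) i) ∧
      (∀ (i : ℕ) (hi : i < l.length), l.get ⟨i, hi⟩ ∉ GR P X →
        ¬ (l.get ⟨i, hi⟩).bodyP ⊆ X ∨
          ∃ L ∈ (l.get ⟨i, hi⟩).bodyN, L ∈ grHeadsBefore l (GR P X) i)

/-- Occurrence of a name in a rule (inside some preference atom). -/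
def nameOccurs {α N : Type} (n : N) (r : ORule α N) : Prop :=
  ∃ L ∈ ruleLits r, ∃ m, L.atom = OAtom.pref n m ∨ L.atom = OAtom.pref m n

/-! ## The translation 𝒯 -/

/-- Atoms of the target language `𝓛⁺` of the translation `𝒯`. -/
inductive TAtom (α N : Type) : Type
  | old : OAtom α N → TAtom α N
  | ap : N → TAtom α N
  | bl : N → TAtom α N
  | ok : N → TAtom α N
  | rdy : N → N → TAtom α N

/-- Embedding of `𝓛`-literals into `𝓛⁺`. -/
def oldLit {α N : Type} (L : Lit (OAtom α N)) : Lit (TAtom α N) := L.map TAtom.old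

/-- The preference literal `(n ≺ m)` inside `𝓛⁺`. -/
def tpref {α N : Type} (n m : N) : Lit (TAtom α N) := Lit.pos (TAtom.old (OAtom.pref n m))

def apLit {α N : Type} (n : N) : Lit (TAtom α N) := Lit.pos (TAtom.ap n)
def blLit {α N : Type} (n : N) : Lit (TAtom α N) := Lit.pos (TAtom.bl n)
def okLit {α N : Type} (n : N) : Lit (TAtom α N) := Lit.pos (TAtom.ok n)
def rdyLit {α N : Type} (n m : N) : Lit (TAtom α N) := Lit.pos (TAtom.rdy n m)

/-- `a1(r) : head(r) ← ap(n_r)`. -/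
def a1Rule {α N : Type} (nm : ORule α N → N) (r : ORule α N) : Rule (TAtom α N) :=
  ⟨oldLit r.head, {apLit (nm r)}, ∅⟩

/-- `a2(r) : ap(n_r) ← ok(n_r), body(r)`. -/
def a2Rule {α N : Type} (nm : ORule α N → N) (r : ORule α N) : Rule (TAtom α N) :=
  ⟨apLit (nm r), insert (okLit (nm r)) (oldLit '' r.bodyP), oldLit '' r.bodyN⟩

/-- `b1(r,L⁺) : bl(n_r) ← ok(n_r), not L⁺`. -/
def b1Rule {α N : Type} (nm : ORule α N → N) (r : ORule α N) (L : Lit (OAtom α N)) :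
    Rule (TAtom α N) :=
  ⟨blLit (nm r), {okLit (nm r)}, {oldLit L}⟩

/-- `b2(r,L⁻) : bl(n_r) ← ok(n_r), L⁻`. -/
def b2Rule {α N : Type} (nm : ORule α N → N) (r : ORule α N) (L : Lit (OAtom α N)) :
    Rule (TAtom α N) :=
  ⟨blLit (nm r), {okLit (nm r), oldLit L}, ∅⟩

/-- `c1(r) : ok(n_r) ← rdy(n_r,n_{r_1}), …, rdy(n_r,n_{r_k})`. -/
def c1Rule {α N : Type} (P : Set (ORule α N)) (nm : ORule α N → N) (r : ORule α N) :
    Rule (TAtom α N) :=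
  ⟨okLit (nm r), {L | ∃ s ∈ P, L = rdyLit (nm r) (nm s)}, ∅⟩

/-- `c2(r,s) : rdy(n_r,n_s) ← not (n_r ≺ n_s)`. -/
def c2Rule {α N : Type} (nm : ORule α N → N) (r s : ORule α N) : Rule (TAtom α N) :=
  ⟨rdyLit (nm r) (nm s), ∅, {tpref (nm r) (nm s)}⟩

/-- `c3(r,s) : rdy(n_r,n_s) ← (n_r ≺ n_s), ap(n_s)`. -/
def c3Rule {α N : Type} (nm : ORule α N → N) (r s : ORule α N) : Rule (TAtom α N) :=
  ⟨rdyLit (nm r) (nm s), {tpref (nm r) (nm s), apLit (nm s)}, ∅⟩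

/-- `c4(r,s) : rdy(n_r,n_s) ← (n_r ≺ n_s), bl(n_s)`. -/
def c4Rule {α N : Type} (nm : ORule α N → N) (r s : ORule α N) : Rule (TAtom α N) :=
  ⟨rdyLit (nm r) (nm s), {tpref (nm r) (nm s), blLit (nm s)}, ∅⟩

/-- `t(r,s,t) : (n_r ≺ n_t) ← (n_r ≺ n_s), (n_s ≺ n_t)` inside `𝓛⁺`. -/
def tRuleT {α N : Type} (nm : ORule α N → N) (r s t : ORule α N) : Rule (TAtom α N) :=
  ⟨tpref (nm r) (nm t), {tpref (nm r) (nm s), tpref (nm s) (nm t)}, ∅⟩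

/-- `as(r,s) : ¬(n_s ≺ n_r) ← (n_r ≺ n_s)` inside `𝓛⁺`. -/
def asRuleT {α N : Type} (nm : ORule α N → N) (r s : ORule α N) : Rule (TAtom α N) :=
  ⟨Lit.neg (TAtom.old (OAtom.pref (nm s) (nm r))), {tpref (nm r) (nm s)}, ∅⟩

/-- The set of rules `τ(r)` of Definition 2. -/
def tau {α N : Type} (P : Set (ORule α N)) (nm : ORule α N → N) (r : ORule α N) :
    Set (Rule (TAtom α N)) :=
  {a1Rule nm r, a2Rule nm r, c1Rule P nm r}
    ∪ {ru | ∃ L ∈ r.bodyP, ru = b1Rule nm r L}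
    ∪ {ru | ∃ L ∈ r.bodyN, ru = b2Rule nm r L}
    ∪ {ru | ∃ s ∈ P, ru = c2Rule nm r s ∨ ru = c3Rule nm r s ∨ ru = c4Rule nm r s}
    ∪ {ru | ∃ s ∈ P, ∃ t ∈ P, ru = tRuleT nm r s t}
    ∪ {ru | ∃ s ∈ P, ru = asRuleT nm r s}

/-- The translation `𝒯(Π) = ⋃_{r ∈ Π} τ(r)`. -/
def TTrans {α N : Type} (P : Set (ORule α N)) (nm : ORule α N → N) :
    Set (Rule (TAtom α N)) :=
  {ru | ∃ r ∈ P, ru ∈ tau P nm r}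

/-- `𝒯(Π,<)` for a statically ordered program. -/
def TStatic {α N : Type} (P : Set (ORule α N)) (nm : ORule α N → N)
    (lt : ORule α N → ORule α N → Prop) : Set (Rule (TAtom α N)) :=
  TTrans (staticProg P nm lt) nm

/-- The dynamically induced preference `r <_X r'` read off from an answer set of
the translated program. -/
def precX {α N : Type} (nm : ORule α N → N) (X : Set (Lit (TAtom α N)))
    (r s : ORule α N) : Prop :=
  tpref (nm r) (nm s) ∈ X

/-- The literals of `𝓛⁺` over regular atoms (the set `𝓛_𝒜`). -/
def regLitsT {α N : Type} : Set (Lit (TAtom α N)) :=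
  {L | ∃ a, L.atom = TAtom.old (OAtom.reg a)}

/-- The literals of `𝓛⁺` belonging to the original language `𝓛`. -/
def oldLitsT {α N : Type} : Set (Lit (TAtom α N)) := Set.range oldLit

/-- A rule of `𝒯(Π)` that is an "image" of `r ∈ Π`:
`a2(r)`, or `b1(r,L)`/`b2(r,L)` for some body literal `L` of `r`. -/
def imgRule {α N : Type} (nm : ORule α N → N) (r : ORule α N)
    (ru : Rule (TAtom α N)) : Prop :=
  ru = a2Rule nm r ∨ (∃ L ∈ r.bodyP, ru = b1Rule nm r L) ∨
    (∃ L ∈ r.bodyN, ru = b2Rule nm r L)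

/-! ## The translation 𝒰 (Brewka–Eiter encoding) -/

/-- Atoms of the target language `𝓛°` of the translation `𝒰`. -/
inductive UAtom (α N : Type) : Type
  | old : OAtom α N → UAtom α N
  | pr : OAtom α N → UAtom α N
  | ap : N → UAtom α N
  | bl : N → UAtom α N
  | ok : N → UAtom α N
  | rdy : N → N → UAtom α N
  | de : N → UAtom α N

def uold {α N : Type} (L : Lit (OAtom α N)) : Lit (UAtom α N) := L.map UAtom.old
def uprimed {α N : Type} (L : Lit (OAtom α N)) : Lit (UAtom α N) := L.map UAtom.pr
def upref {α N : Type} (n m : N) : Lit (UAtom α N) := Lit.pos (UAtom.old (OAtom.pref n m))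
def uapLit {α N : Type} (n : N) : Lit (UAtom α N) := Lit.pos (UAtom.ap n)
def ublLit {α N : Type} (n : N) : Lit (UAtom α N) := Lit.pos (UAtom.bl n)
def uokLit {α N : Type} (n : N) : Lit (UAtom α N) := Lit.pos (UAtom.ok n)
def urdyLit {α N : Type} (n m : N) : Lit (UAtom α N) := Lit.pos (UAtom.rdy n m)
def udeLit {α N : Type} (n : N) : Lit (UAtom α N) := Lit.pos (UAtom.de n)

/-- `a1(r) : head(r') ← ap(n_r)`. -/
def ua1 {α N : Type} (nm : ORule α N → N) (r : ORule α N) : Rule (UAtom α N) :=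
  ⟨uprimed r.head, {uapLit (nm r)}, ∅⟩

/-- `a2(r) : ap(n_r) ← ok(n_r), body(r), not body⁻(r')`. -/
def ua2 {α N : Type} (nm : ORule α N → N) (r : ORule α N) : Rule (UAtom α N) :=
  ⟨uapLit (nm r), insert (uokLit (nm r)) (uold '' r.bodyP),
    uold '' r.bodyN ∪ uprimed '' r.bodyN⟩

/-- `b1(r,L) : bl(n_r) ← ok(n_r), not L, not L'`. -/
def ub1 {α N : Type} (nm : ORule α N → N) (r : ORule α N) (L : Lit (OAtom α N)) :
    Rule (UAtom α N) :=
  ⟨ublLit (nm r), {uokLit (nm r)}, {uold L, uprimed L}⟩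

/-- `b2(r,K) : bl(n_r) ← ok(n_r), K, K'`. -/
def ub2 {α N : Type} (nm : ORule α N → N) (r : ORule α N) (K : Lit (OAtom α N)) :
    Rule (UAtom α N) :=
  ⟨ublLit (nm r), {uokLit (nm r), uold K, uprimed K}, ∅⟩

/-- `c1(r) : ok(n_r) ← rdy(n_r,n_{r_1}), …, rdy(n_r,n_{r_k})`. -/
def uc1 {α N : Type} (P : Set (ORule α N)) (nm : ORule α N → N) (r : ORule α N) :
    Rule (UAtom α N) :=
  ⟨uokLit (nm r), {L | ∃ s ∈ P, L = urdyLit (nm r) (nm s)}, ∅⟩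

/-- `c2(r,s) : rdy(n_r,n_s) ← not (n_r ≺ n_s)`. -/
def uc2 {α N : Type} (nm : ORule α N → N) (r s : ORule α N) : Rule (UAtom α N) :=
  ⟨urdyLit (nm r) (nm s), ∅, {upref (nm r) (nm s)}⟩

/-- `c3(r,s) : rdy(n_r,n_s) ← (n_r ≺ n_s), ap(n_s)`. -/
def uc3 {α N : Type} (nm : ORule α N → N) (r s : ORule α N) : Rule (UAtom α N) :=
  ⟨urdyLit (nm r) (nm s), {upref (nm r) (nm s), uapLit (nm s)}, ∅⟩

/-- `c4(r,s) : rdy(n_r,n_s) ← (n_r ≺ n_s), bl(n_s)`. -/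
def uc4 {α N : Type} (nm : ORule α N → N) (r s : ORule α N) : Rule (UAtom α N) :=
  ⟨urdyLit (nm r) (nm s), {upref (nm r) (nm s), ublLit (nm s)}, ∅⟩

/-- `c5(r,s,J) : rdy(n_r,n_s) ← head(s), J`. -/
def uc5 {α N : Type} (nm : ORule α N → N) (r s : ORule α N) (J : Lit (OAtom α N)) :
    Rule (UAtom α N) :=
  ⟨urdyLit (nm r) (nm s), {uold s.head, uold J}, ∅⟩

/-- The constraint `de(r) : ← not ok(n_r)`, rendered as
`p_r ← not ok(n_r), not p_r` for the fresh atom `p_r = de(n_r)`. -/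
def ude {α N : Type} (nm : ORule α N → N) (r : ORule α N) : Rule (UAtom α N) :=
  ⟨udeLit (nm r), ∅, {uokLit (nm r), udeLit (nm r)}⟩

/-- Transitivity rule inside `𝓛°`. -/
def utr {α N : Type} (nm : ORule α N → N) (r s t : ORule α N) : Rule (UAtom α N) :=
  ⟨upref (nm r) (nm t), {upref (nm r) (nm s), upref (nm s) (nm t)}, ∅⟩

/-- Antisymmetry rule inside `𝓛°`. -/
def uas {α N : Type} (nm : ORule α N → N) (r s : ORule α N) : Rule (UAtom α N) :=
  ⟨Lit.neg (UAtom.old (OAtom.pref (nm s) (nm r))), {upref (nm r) (nm s)}, ∅⟩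

/-- The set of rules `τ(r)` of Definition 8. -/
def utau {α N : Type} (P : Set (ORule α N)) (nm : ORule α N → N) (r : ORule α N) :
    Set (Rule (UAtom α N)) :=
  {ua1 nm r, ua2 nm r, uc1 P nm r, ude nm r}
    ∪ {ru | ∃ L ∈ r.bodyP, ru = ub1 nm r L}
    ∪ {ru | ∃ K ∈ r.bodyN, ru = ub2 nm r K}
    ∪ {ru | ∃ s ∈ P, ru = uc2 nm r s ∨ ru = uc3 nm r s ∨ ru = uc4 nm r s}
    ∪ {ru | ∃ s ∈ P, ∃ J ∈ s.bodyN, ru = uc5 nm r s J}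
    ∪ {ru | ∃ s ∈ P, ∃ t ∈ P, ru = utr nm r s t}
    ∪ {ru | ∃ s ∈ P, ru = uas nm r s}

/-- The translation `𝒰(Π) = Π ∪ ⋃_{r ∈ Π} τ(r)`. -/
def UTrans {α N : Type} (P : Set (ORule α N)) (nm : ORule α N → N) :
    Set (Rule (UAtom α N)) :=
  (Rule.map UAtom.old) '' P ∪ {ru | ∃ r ∈ P, ru ∈ utau P nm r}

/-- The fact `(n_r ≺ n_s) ←` inside `𝓛°`. -/
def uPrefFact {α N : Type} (nm : ORule α N → N) (r s : ORule α N) : Rule (UAtom α N) :=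
  ⟨upref (nm r) (nm s), ∅, ∅⟩

/-- The literals of `𝓛°` over regular atoms (the set `𝓛_𝒜`). -/
def regLitsU {α N : Type} : Set (Lit (UAtom α N)) :=
  {L | ∃ a, L.atom = UAtom.old (OAtom.reg a)}

/-! ## Brewka–Eiter preferred answer sets -/

/-- `reductBE r = head(r) ← not body⁻(r)`. -/
def reductBE {γ : Type} (r : Rule γ) : Rule γ := ⟨r.head, ∅, r.bodyN⟩

/-- The sequence `X_i` of Definition 5 (for the enumeration `l` and the set `X`). -/
def CSeq {γ : Type} (l : List (Rule γ)) (X : Set (Lit γ)) : ℕ → Set (Lit γ)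
  | 0 => ∅
  | i + 1 =>
    CSeq l X i ∪
      {L | ∃ h : i < l.length,
        ¬ defeated (l.get ⟨i, h⟩) (CSeq l X i) ∧
        ¬ ((l.get ⟨i, h⟩).head ∈ X ∧ defeated (l.get ⟨i, h⟩) X) ∧
        L = (l.get ⟨i, h⟩).head}

/-- The operator `C` of Definition 5. -/
def COp {γ : Type} (l : List (Rule γ)) (X : Set (Lit γ)) : Set (Lit γ) :=
  logClosure (⋃ i, CSeq l X i)

/-- `l` is the enumeration of `P` according to the total order `ll`
(most preferred rule first). -/
def descList {γ : Type} (l : List (Rule γ)) (P : Set (Rule γ))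
    (ll : Rule γ → Rule γ → Prop) : Prop :=
  enumerates l P ∧
    ∀ (i j : ℕ) (hi : i < l.length) (hj : j < l.length), i < j →
      ll (l.get ⟨j, hj⟩) (l.get ⟨i, hi⟩)

/-- `X` is the BE-preferred answer set of the fully ordered prerequisite-free
program `(P,ll)`. -/
def BEPrefPF {γ : Type} (P : Set (Rule γ)) (ll : Rule γ → Rule γ → Prop)
    (X : Set (Lit γ)) : Prop :=
  ∃ l, descList l P ll ∧ COp l X = X

/-- The program `Π_X` of Definition 7. -/
def PiX {γ : Type} (P : Set (Rule γ)) (X : Set (Lit γ)) : Set (Rule γ) :=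
  {r' | ∃ r ∈ P, r.bodyP ⊆ X ∧ r' = reductBE r}

/-- `r` is the `ll`-maximal rule of `P` whose BE-reduct is `a`. -/
def beMax {γ : Type} (P : Set (Rule γ)) (ll : Rule γ → Rule γ → Prop)
    (a r : Rule γ) : Prop :=
  r ∈ P ∧ reductBE r = a ∧ ∀ s ∈ P, reductBE s = a → s = r ∨ ll s r

/-- The inherited order `ll_X` of Definition 7. -/
def llX {γ : Type} (P : Set (Rule γ)) (ll : Rule γ → Rule γ → Prop)
    (a b : Rule γ) : Prop :=
  ∃ r1 r2, beMax P ll a r1 ∧ beMax P ll b r2 ∧ ll r1 r2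

/-- `X` is a BE-preferred answer set of the fully ordered program `(P,ll)`. -/
def BEPrefFull {γ : Type} (P : Set (Rule γ)) (ll : Rule γ → Rule γ → Prop)
    (X : Set (Lit γ)) : Prop :=
  answerSet P X ∧ BEPrefPF (PiX P X) (llX P ll) X

/-- `X` is a BE-preferred answer set of the statically ordered program `(P,lt)`. -/
def BEPreferred {γ : Type} (P : Set (Rule γ)) (lt : Rule γ → Rule γ → Prop)
    (X : Set (Lit γ)) : Prop :=
  ∃ ll, totalStrictOn P ll ∧ (∀ a b, lt a b → ll a b) ∧ BEPrefFull P ll X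


section Grounded

variable {α : Type}

/-- Each rule of `l` has its prerequisites among the heads of the rules before it. -/
def SupportedList (l : List (Rule α)) : Prop :=
  ∀ (i : ℕ) (h : i < l.length), (l.get ⟨i, h⟩).bodyP ⊆ headsBefore l i

/-- The heads of the rules of a list. -/
def listHeads (l : List (Rule α)) : Set (Lit α) := {L | ∃ r ∈ l, r.head = L}

lemma SupportedList.concat {l : List (Rule α)} (hl : SupportedList l) {r : Rule α}
    (hr : r.bodyP ⊆ listHeads l) : SupportedList (l ++ [r]) := by
  intro i h
  rcases lt_or_ge i l.length with hi | hi
  · have := hl i hi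
    simpa [headsBefore, List.getElem_append_left hi, List.take_append_of_le_length hi.le]
      using this
  · obtain rfl : i = l.length := by
      simp at h
      omega
    simpa [headsBefore, listHeads] using hr

/-- A finite set of rules contains a supported list that cannot be extended. -/
lemma exists_maximal_supportedList {G : Set (Rule α)} (hG : G.Finite) :
    ∃ l : List (Rule α), l.Nodup ∧ (∀ r ∈ l, r ∈ G) ∧ SupportedList l ∧
      ∀ r ∈ G, r.bodyP ⊆ listHeads l → r ∈ l := by
  classical
  by_contra hcon
  push Not at hcon
  have hlen : ∀ n : ℕ, ∃ l : List (Rule α), l.Nodup ∧ (∀ r ∈ l, r ∈ G) ∧ SupportedList l ∧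
      l.length = n := by
    intro n
    induction n with
    | zero => exact ⟨[], by simp, by simp, fun i h => absurd h (by simp), rfl⟩
    | succ n ih =>
      obtain ⟨l, hnd, hsub, hsup, rfl⟩ := ih
      obtain ⟨r, hrG, hrb, hrl⟩ := hcon l hnd hsub hsup
      refine ⟨l ++ [r], ?_, ?_, hsup.concat hrb, by simp⟩
      · exact hnd.append (by simp) (by simpa using hrl)
      · intro s hs
        rcases List.mem_append.1 hs with hs | hs
        · exact hsub s hs
        · rw [List.mem_singleton.1 hs]
          exact hrG
  obtain ⟨l, hnd, hsub, -, hl⟩ := hlen (hG.toFinset.card + 1)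
  have hcard : l.toFinset.card ≤ hG.toFinset.card :=
    Finset.card_le_card fun r hr => hG.mem_toFinset.2 (hsub r (List.mem_toFinset.1 hr))
  rw [List.toFinset_card_of_nodup hnd] at hcard
  omega

lemma consistent.mono {X Y : Set (Lit α)} (hX : consistent X) (h : Y ⊆ X) : consistent Y :=
  fun ⟨a, hp, hn⟩ => hX ⟨a, h hp, h hn⟩

lemma closedUnder_reduct_iff {P : Set (Rule α)} {X Y : Set (Lit α)} :
    closedUnder (reduct P X) Y ↔ ∀ r ∈ P, ¬ defeated r X → r.bodyP ⊆ Y → r.head ∈ Y := by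
  constructor
  · exact fun h r hr hd => h ⟨r.head, r.bodyP, ∅⟩ ⟨r, hr, hd, rfl⟩
  · rintro h _ ⟨r, hr, hd, rfl⟩
    exact h r hr hd

/-- A consistent set is an answer set iff it is the least closed set among its subsets. -/
lemma answerSet_iff {P : Set (Rule α)} {X : Set (Lit α)} (hX : consistent X) :
    answerSet P X ↔ closedUnder (reduct P X) X ∧
      ∀ Y ⊆ X, closedUnder (reduct P X) Y → X ⊆ Y := by
  constructor
  · intro h
    have hclosed : closedUnder (reduct P X) X := by
      intro r hr hb
      rw [← h]
      rintro Y ⟨hY, hcY⟩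
      refine hcY r hr (hb.trans ?_)
      rw [← h]
      exact Set.sInter_subset_of_mem ⟨hY, hcY⟩
    refine ⟨hclosed, fun Y hYX hY => ?_⟩
    conv_lhs => rw [← h]
    exact Set.sInter_subset_of_mem ⟨Or.inl (hX.mono hYX), hY⟩
  · rintro ⟨hc, hmin⟩
    refine Set.Subset.antisymm (Set.sInter_subset_of_mem ⟨Or.inl hX, hc⟩) ?_
    rintro L hL Y ⟨-, hY⟩
    have hsub : X ⊆ Y ∩ X := hmin _ Set.inter_subset_right fun r hr hb =>
      ⟨hY r hr (hb.trans Set.inter_subset_left), hc r hr (hb.trans Set.inter_subset_right)⟩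
    exact (hsub hL).1

/-- The generating rules of a consistent answer set admit a supported enumeration, and their
heads make up the answer set. -/
lemma answerSet.exists_supportedList {P : Set (Rule α)} {X : Set (Lit α)} (hfin : P.Finite)
    (hX : consistent X) (h : answerSet P X) :
    ∃ l : List (Rule α), enumerates l (GR P X) ∧ SupportedList l ∧ listHeads l = X := by
  obtain ⟨hc, hmin⟩ := (answerSet_iff hX).1 h
  rw [closedUnder_reduct_iff] at hc
  obtain ⟨l, hnd, hsub, hsup, hmax⟩ :=
    exists_maximal_supportedList (hfin.subset fun r (hr : r ∈ GR P X) => hr.1)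
  have hle : listHeads l ⊆ X := by
    rintro _ ⟨r, hr, rfl⟩
    obtain ⟨hrP, hrb, hrd⟩ := hsub r hr
    exact hc r hrP hrd hrb
  have hge : X ⊆ listHeads l := hmin _ hle <| closedUnder_reduct_iff.2 fun r hr hd hb =>
    ⟨r, hmax r ⟨hr, hb.trans hle, hd⟩ hb, rfl⟩
  exact ⟨l, ⟨hnd, Set.Subset.antisymm hsub fun r hr => hmax r hr (hr.2.1.trans hge)⟩,
    hsup, hle.antisymm hge⟩

end Grounded

section Ordered

variable {α N : Type} {P : Set (ORule α N)} {nm : ORule α N → N} {X : Set (Lit (OAtom α N))}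

lemma answerSet.staticPreserving_false (hfin : P.Finite) (hX : consistent X)
    (h : answerSet P X) : staticPreserving P (fun _ _ => False) X := by
  obtain ⟨l, hl, hsup, -⟩ := h.exists_supportedList hfin hX
  exact ⟨h, hX, l, hl, hsup, fun _ _ _ _ hF => hF.elim, fun _ _ _ _ _ hF => hF.elim⟩

lemma answerSet.regLitO_of_mem (hreg : ∀ r ∈ P, noPref r) (hX : consistent X)
    (h : answerSet P X) {L : Lit (OAtom α N)} (hL : L ∈ X) : regLitO L := by
  obtain ⟨hc, hmin⟩ := (answerSet_iff hX).1 h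
  rw [closedUnder_reduct_iff] at hc
  have hsub : X ⊆ {L ∈ X | regLitO L} := hmin _ (Set.sep_subset _ _) <|
    closedUnder_reduct_iff.2 fun r hr hd hb =>
      ⟨hc r hr hd (hb.trans (Set.sep_subset _ _)), hreg r hr _ (Set.mem_insert _ _)⟩
  exact (hsub hL).2

lemma subset_TA : P ⊆ TA P nm := fun _ hr => Or.inl (Or.inl hr)

lemma TA_finite (hfin : P.Finite) : (TA P nm).Finite := by
  refine (hfin.union ?_).union ?_
  · refine ((hfin.prod (hfin.prod hfin)).image fun p => tRuleO nm p.1 p.2.1 p.2.2).subset ?_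
    rintro _ ⟨r, hr, s, hs, t, ht, rfl⟩
    exact ⟨(r, s, t), ⟨hr, hs, ht⟩, rfl⟩
  · refine ((hfin.prod hfin).image fun p => asRuleO nm p.1 p.2).subset ?_
    rintro _ ⟨r, hr, s, hs, rfl⟩
    exact ⟨(r, s), ⟨hr, hs⟩, rfl⟩

/-- Without preference literals in `X`, only rules of `P` are applicable in `TA P nm`. -/
lemma mem_of_mem_TA_of_bodyP_subset (hpref : ∀ n m : N, prefLit n m ∉ X) {r : ORule α N}
    (hr : r ∈ TA P nm) (hb : r.bodyP ⊆ X) : r ∈ P := by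
  rcases hr with (hr | ⟨r, -, s, -, t, -, rfl⟩) | ⟨r, -, s, -, rfl⟩
  · exact hr
  · exact absurd (hb (Set.mem_insert _ _)) (hpref _ _)
  · exact absurd (hb (Set.mem_singleton _)) (hpref _ _)

lemma GR_TA (hpref : ∀ n m : N, prefLit n m ∉ X) : GR (TA P nm) X = GR P X := by
  ext r
  exact ⟨fun ⟨hr, hb, hd⟩ => ⟨mem_of_mem_TA_of_bodyP_subset hpref hr hb, hb, hd⟩,
    fun ⟨hr, hb, hd⟩ => ⟨subset_TA hr, hb, hd⟩⟩

lemma answerSet_TA_iff (hX : consistent X) (hpref : ∀ n m : N, prefLit n m ∉ X) :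
    answerSet (TA P nm) X ↔ answerSet P X := by
  have hcl : ∀ Y ⊆ X, closedUnder (reduct (TA P nm) X) Y ↔ closedUnder (reduct P X) Y := by
    intro Y hY
    simp only [closedUnder_reduct_iff]
    exact ⟨fun h r hr => h r (subset_TA hr), fun h r hr hd hb =>
      h r (mem_of_mem_TA_of_bodyP_subset hpref hr (hb.trans hY)) hd hb⟩
  rw [answerSet_iff hX, answerSet_iff hX, hcl X subset_rfl]
  exact and_congr_right fun _ => forall₂_congr fun Y hY => by rw [hcl Y hY]

lemma answerSet.dynPreserving_TA (hfin : P.Finite) (hX : consistent X)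
    (hpref : ∀ n m : N, prefLit n m ∉ X) (h : answerSet P X) :
    dynPreserving nm (TA P nm) X := by
  classical
  obtain ⟨l, ⟨hnd, hmem⟩, hsup, hheads⟩ := h.exists_supportedList hfin hX
  have hmem' : ∀ r, r ∈ l ↔ r ∈ GR P X := fun r => by rw [← hmem]; rfl
  have hrest : (TA P nm \ GR P X).Finite := (TA_finite hfin).subset Set.sdiff_subset
  set m := hrest.toFinset.toList with hm
  have hmem_m : ∀ r, r ∈ m ↔ r ∈ TA P nm ∧ r ∉ GR P X := by simp [hm]
  have hbefore : ∀ i k (hk : k < l.length), k < i →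
      l[k].head ∈ grHeadsBefore (l ++ m) (GR P X) i := by
    intro i k hk hki
    refine ⟨k, by rw [List.length_append]; omega, hki, ?_, ?_⟩
    · simpa [List.getElem_append_left hk] using (hmem' _).1 (List.getElem_mem hk)
    · simp [List.getElem_append_left hk]
  refine ⟨(answerSet_TA_iff hX hpref).2 h, hX, l ++ m, ⟨?_, ?_⟩,
    fun _ _ _ _ hp => absurd hp (hpref _ _), fun _ _ _ _ hp => absurd hp (hpref _ _), ?_, ?_⟩
  · refine hnd.append (Finset.nodup_toList _) fun r hr hrm => ?_
    exact ((hmem_m r).1 hrm).2 ((hmem' r).1 hr)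
  · ext r
    simp only [Set.mem_ofPred_eq, List.mem_append, hmem', hmem_m]
    by_cases hr : r ∈ GR P X
    · exact ⟨fun _ => subset_TA hr.1, fun _ => Or.inl hr⟩
    · exact ⟨fun h => (h.resolve_left hr).1, fun h => Or.inr ⟨h, hr⟩⟩
  · rw [GR_TA hpref]
    intro i hi hG
    rcases lt_or_ge i l.length with hil | hil
    · rw [List.get_eq_getElem, List.getElem_append_left hil]
      intro L hL
      have hL' := hsup i hil hL
      simp only [headsBefore, Set.mem_ofPred_eq, List.mem_map, List.mem_take_iff_getElem] at hL'
      obtain ⟨_, ⟨k, hk, rfl⟩, rfl⟩ := hL'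
      exact hbefore i k (by omega) (by omega)
    · rw [List.get_eq_getElem, List.getElem_append_right hil] at hG
      exact absurd hG ((hmem_m _).1 (List.getElem_mem _)).2
  · rw [GR_TA hpref]
    intro i hi hG
    have hil : l.length ≤ i := by
      by_contra! hil
      rw [List.get_eq_getElem, List.getElem_append_left hil] at hG
      exact hG ((hmem' _).1 (List.getElem_mem hil))
    rw [← GR_TA (P := P) (nm := nm) hpref] at hG
    have hTA : (l ++ m).get ⟨i, hi⟩ ∈ TA P nm := by
      rw [List.get_eq_getElem, List.getElem_append_right hil]
      exact ((hmem_m _).1 (List.getElem_mem _)).1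
    by_cases hb : ((l ++ m).get ⟨i, hi⟩).bodyP ⊆ X
    · right
      have hd : defeated ((l ++ m).get ⟨i, hi⟩) X := by
        by_contra hd
        exact hG ⟨hTA, hb, hd⟩
      obtain ⟨L, hL, hLX⟩ := hd
      refine ⟨L, hL, ?_⟩
      rw [← hheads] at hLX
      obtain ⟨r, hr, rfl⟩ := hLX
      obtain ⟨k, hk, rfl⟩ := List.getElem_of_mem hr
      exact hbefore i k hk (by omega)
    · exact Or.inl hb

end Ordered

theorem stmt12 {α N : Type} (P : Set (ORule α N)) (nm : ORule α N → N)
    (hfin : P.Finite) (hnm : Set.BijOn nm P Set.univ)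
    (hreg : ∀ r ∈ P, noPref r)
    (X : Set (Lit (OAtom α N))) (hX : consistent X) :
    ((dynPreserving nm (TA P nm) X ∧
        ∀ r ∈ TA P nm, ∀ s ∈ TA P nm, ¬ precXO nm X r s) ↔
      staticPreserving P (fun _ _ => False) X) ∧
    (staticPreserving P (fun _ _ => False) X ↔ answerSet P X) := by
  refine ⟨⟨fun ⟨hdyn, hprec⟩ => ?_, fun hst => ?_⟩,
    fun hst => hst.1, fun h => h.staticPreserving_false hfin hX⟩
  · have hpref : ∀ n m : N, prefLit n m ∉ X := by
      intro n m
      obtain ⟨r, hr, rfl⟩ := hnm.surjOn (Set.mem_univ n)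
      obtain ⟨s, hs, rfl⟩ := hnm.surjOn (Set.mem_univ m)
      exact hprec r (subset_TA hr) s (subset_TA hs)
    exact ((answerSet_TA_iff hX hpref).1 hdyn.1).staticPreserving_false hfin hX
  · have hpref : ∀ n m : N, prefLit n m ∉ X := by
      intro n m hL
      obtain ⟨a, ha⟩ := hst.1.regLitO_of_mem hreg hX hL
      cases ha
    exact ⟨hst.1.dynPreserving_TA hfin hX hpref, fun r _ s _ => hpref _ _⟩

end ASP
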